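/- Let G be a plane graph all of whose faces are 4-faces except for one 6-face F with boundary cycle v1v2v3v4v5v6. Then G has no proper 3-coloring φ with φ(v1)=φ(v4)=1, φ(v2)=φ(v5)=2, φ(v3)=φ(v6)=3. -/

import Mathlib

universe u
variable {V : Type u}



/-- A topological embedding (drawing) of a simple graph in a topological space `X`:
vertices map to distinct points, edges map to arcs meeting only at common endpoints. -/
structure GraphEmbeddingIn (X : Type*) [TopologicalSpace X] (G : SimpleGraph V) where
  vertexPos : V → X
  vertexInj : Function.Injective vertexPos
  edgeArc : ∀ u v : V, G.Adj u v → ℝ → X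
  arc_cont : ∀ u v h, ContinuousOn (edgeArc u v h) (Set.Icc 0 1)
  arc_injOn : ∀ u v h, Set.InjOn (edgeArc u v h) (Set.Icc 0 1)
  arc_start : ∀ u v h, edgeArc u v h 0 = vertexPos u
  arc_end : ∀ u v h, edgeArc u v h 1 = vertexPos v
  arc_avoid : ∀ u v h (w : V), vertexPos w ∉ edgeArc u v h '' Set.Ioo 0 1
  arc_disjoint : ∀ u v h u' v' h', s(u, v) ≠ s(u', v') →
    edgeArc u v h '' Set.Ioo 0 1 ∩ edgeArc u' v' h' '' Set.Icc 0 1 = ∅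

/-- A graph is planar if it has a drawing in the plane. -/
def SimpleGraph.IsPlanar (G : SimpleGraph V) : Prop :=
  Nonempty (GraphEmbeddingIn (ℝ × ℝ) G)


variable {X : Type*} [TopologicalSpace X] {G : SimpleGraph V}

/-- The point set of the drawing. -/
def GraphEmbeddingIn.drawing (E : GraphEmbeddingIn X G) : Set X :=
  Set.range E.vertexPos ∪ ⋃ (u) (v) (h : G.Adj u v), E.edgeArc u v h '' Set.Icc 0 1

/-- The point set of the drawing of a closed walk. -/
def GraphEmbeddingIn.walkDrawing (E : GraphEmbeddingIn X G) {v : V} (W : G.Walk v v) : Set X :=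
  ⋃ d ∈ W.darts, E.edgeArc d.toProd.1 d.toProd.2 d.adj '' Set.Icc 0 1

/-- A face of the drawing: a connected component of the complement of the drawing. -/
def GraphEmbeddingIn.IsFace (E : GraphEmbeddingIn X G) (F : Set X) : Prop :=
  ∃ x ∈ E.drawingᶜ, F = connectedComponentIn E.drawingᶜ x

open Complex in
/-- `f` has a continuous logarithm on `S`. -/
def HasLogOn {X : Type*} [TopologicalSpace X] (f : X → ℂ) (S : Set X) : Prop :=
  ∃ g : X → ℂ, ContinuousOn g S ∧ ∀ z ∈ S, exp (g z) = f z

namespace HasLogOn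

variable {X : Type*} [TopologicalSpace X] {f g : X → ℂ} {S T : Set X}

theorem mono (h : HasLogOn f S) (hT : T ⊆ S) : HasLogOn f T :=
  let ⟨a, ha, he⟩ := h
  ⟨a, ha.mono hT, fun z hz => he z (hT hz)⟩

theorem congr (h : HasLogOn f S) (hfg : ∀ z ∈ S, f z = g z) : HasLogOn g S :=
  let ⟨a, ha, he⟩ := h
  ⟨a, ha, fun z hz => (he z hz).trans (hfg z hz)⟩

theorem ne_zero (h : HasLogOn f S) {z : X} (hz : z ∈ S) : f z ≠ 0 := by
  obtain ⟨a, -, he⟩ := h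
  rw [← he z hz]
  exact Complex.exp_ne_zero _

theorem mul (hf : HasLogOn f S) (hg : HasLogOn g S) : HasLogOn (fun z => f z * g z) S := by
  obtain ⟨a, ha, hea⟩ := hf
  obtain ⟨b, hb, heb⟩ := hg
  exact ⟨fun z => a z + b z, ha.add hb, fun z hz => by
    rw [Complex.exp_add, hea z hz, heb z hz]⟩

theorem zpow (hf : HasLogOn f S) (n : ℤ) : HasLogOn (fun z => f z ^ n) S := by
  obtain ⟨a, ha, hea⟩ := hf
  exact ⟨fun z => n * a z, continuousOn_const.mul ha, fun z hz => by
    rw [Complex.exp_int_mul, hea z hz]⟩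

theorem inv (hf : HasLogOn f S) : HasLogOn (fun z => (f z)⁻¹) S :=
  (hf.zpow (-1)).congr fun _ _ => zpow_neg_one _

theorem const {c : ℂ} (hc : c ≠ 0) : HasLogOn (fun _ : X => c) S :=
  ⟨fun _ => Complex.log c, continuousOn_const, fun _ _ => Complex.exp_log hc⟩

theorem of_slitPlane (hf : ContinuousOn f S) (h : ∀ z ∈ S, f z ∈ Complex.slitPlane) :
    HasLogOn f S :=
  ⟨fun z => Complex.log (f z), hf.clog h,
    fun z hz => Complex.exp_log (Complex.slitPlane_ne_zero (h z hz))⟩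

theorem of_norm_sub_one_lt (hf : ContinuousOn f S) (h : ∀ z ∈ S, ‖f z - 1‖ < 1) :
    HasLogOn f S :=
  of_slitPlane hf fun z hz => by
    simpa using Complex.mem_slitPlane_of_norm_lt_one (h z hz)

theorem empty : HasLogOn f ∅ := ⟨fun _ => 0, continuousOn_empty _, by simp⟩

end HasLogOn

theorem sub_eq_sub_of_exp_eq {X : Type*} [TopologicalSpace X] {S : Set X}
    (hS : IsPreconnected S) {a b : X → ℂ} (ha : ContinuousOn a S) (hb : ContinuousOn b S)
    (h : ∀ z ∈ S, Complex.exp (a z) = Complex.exp (b z)) {x y : X} (hx : x ∈ S) (hy : y ∈ S) :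
    a x - b x = a y - b y := by
  have hc : ContinuousOn (fun z => (a z - b z) / (2 * Real.pi * Complex.I)) S :=
    (ha.sub hb).div_const _
  have := hS.constant_of_mapsTo
    Complex.isClosedEmbedding_intCast.isEmbedding.isDiscrete_range hc (fun z hz => by
    obtain ⟨n, hn⟩ := Complex.exp_eq_exp_iff_exists_int.1 (h z hz)
    refine ⟨n, ?_⟩
    simp only [hn]
    field_simp [Complex.two_pi_I_ne_zero]
    ring) hx hy
  exact (div_left_inj' Complex.two_pi_I_ne_zero).1 this

/-- The products of integer powers of functions `z ↦ z - p` with `p` outside `K`. -/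
def linearProducts (K : Set ℂ) : Submonoid (ℂ → ℂ) :=
  Submonoid.closure {r | ∃ p ∉ K, ∃ m : ℤ, r = fun z => (z - p) ^ m}

theorem sub_zpow_mem_linearProducts {K : Set ℂ} {p : ℂ} (hp : p ∉ K) (m : ℤ) :
    (fun z => (z - p) ^ m) ∈ linearProducts K :=
  Submonoid.subset_closure ⟨p, hp, m, rfl⟩

/-- Up to a product of linear factors with zeros off `K`, `f` has a continuous logarithm. -/
def HasLogModLinear (f : ℂ → ℂ) (K : Set ℂ) : Prop :=
  ∃ r ∈ linearProducts K, HasLogOn (fun z => f z * r z) K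

theorem mem_slitPlane_of_re_nonneg {w : ℂ} (h : 0 ≤ w.re) (h0 : w ≠ 0) :
    w ∈ Complex.slitPlane := by
  rw [Complex.mem_slitPlane_iff]
  rcases h.lt_or_eq with h | h
  · exact Or.inl h
  · exact Or.inr fun h' => h0 (Complex.ext h.symm h')

theorem hasLogOn_sub_of_re_nonneg {u p : ℂ} (hu : u ≠ 0) {S : Set ℂ}
    (hS : ∀ z ∈ S, z ≠ p ∧ 0 ≤ (u * (z - p)).re) : HasLogOn (fun z => z - p) S := by
  have h1 : HasLogOn (fun z => u * (z - p)) S :=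
    .of_slitPlane (by fun_prop) fun z hz =>
      mem_slitPlane_of_re_nonneg (hS z hz).2 (mul_ne_zero hu (sub_ne_zero.2 (hS z hz).1))
  refine ((HasLogOn.const (inv_ne_zero hu)).mul h1).congr fun z _ => ?_
  field_simp

theorem hasLogOn_sub_of_re_nonpos {u p : ℂ} (hu : u ≠ 0) {S : Set ℂ}
    (hS : ∀ z ∈ S, z ≠ p ∧ (u * (z - p)).re ≤ 0) : HasLogOn (fun z => z - p) S :=
  hasLogOn_sub_of_re_nonneg (neg_ne_zero.2 hu) fun z hz => ⟨(hS z hz).1, by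
    have := (hS z hz).2
    rw [neg_mul, Complex.neg_re]
    linarith⟩

theorem log_sub_log_neg_of_im_pos {w : ℂ} (h : 0 < w.im) :
    Complex.log w - Complex.log (-w) = Real.pi * Complex.I := by
  simp only [Complex.log, norm_neg, Complex.arg_neg_eq_arg_sub_pi_of_im_pos h]
  push_cast
  ring

theorem log_sub_log_neg_of_im_neg {w : ℂ} (h : w.im < 0) :
    Complex.log w - Complex.log (-w) = -(Real.pi * Complex.I) := by
  simp only [Complex.log, norm_neg, Complex.arg_neg_eq_arg_add_pi_of_im_neg h]
  push_cast
  ring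

/-- Logarithms of `z - p` on the two closed half-planes bounded by a line through `p`, which agree
on one of the rays of that line and differ by `2πi` on the other. -/
theorem exists_log_pair {u : ℂ} (hu : u ≠ 0) (p : ℂ) :
    ∃ a b : ℂ → ℂ,
      (ContinuousOn a {z | z ≠ p ∧ (u * z).re ≤ (u * p).re} ∧
        ∀ z, z ≠ p → Complex.exp (a z) = z - p) ∧
      (ContinuousOn b {z | z ≠ p ∧ (u * p).re ≤ (u * z).re} ∧
        ∀ z, z ≠ p → Complex.exp (b z) = z - p) ∧
      (∀ z, (u * z).im < (u * p).im → a z - b z = 0) ∧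
      ∀ z, (u * p).im < (u * z).im → a z - b z = -(2 * Real.pi * Complex.I) := by
  refine ⟨fun z => Complex.log (-(u * (z - p))) - Real.pi * Complex.I - Complex.log u,
    fun z => Complex.log (u * (z - p)) - Complex.log u, ⟨?_, ?_⟩, ⟨?_, ?_⟩, ?_, ?_⟩
  · refine ((ContinuousOn.clog (by fun_prop) fun z hz => ?_).sub continuousOn_const).sub
      continuousOn_const
    refine mem_slitPlane_of_re_nonneg ?_
      (neg_ne_zero.2 (mul_ne_zero hu (sub_ne_zero.2 hz.1)))
    have := hz.2
    rw [mul_sub, Complex.neg_re, Complex.sub_re]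
    linarith
  · intro z hz
    have hz' := sub_ne_zero.2 hz
    rw [Complex.exp_sub, Complex.exp_sub, Complex.exp_pi_mul_I, Complex.exp_log hu,
      Complex.exp_log (neg_ne_zero.2 (mul_ne_zero hu hz'))]
    field_simp
  · refine (ContinuousOn.clog (by fun_prop) fun z hz => ?_).sub continuousOn_const
    refine mem_slitPlane_of_re_nonneg ?_ (mul_ne_zero hu (sub_ne_zero.2 hz.1))
    have := hz.2
    rw [mul_sub, Complex.sub_re]
    linarith
  · intro z hz
    have hz' := sub_ne_zero.2 hz
    rw [Complex.exp_sub, Complex.exp_log hu, Complex.exp_log (mul_ne_zero hu hz')]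
    field_simp
  · intro z hz
    have := log_sub_log_neg_of_im_neg (w := u * (z - p)) (by
      rw [mul_sub, Complex.sub_im]; linarith)
    linear_combination -this
  · intro z hz
    have := log_sub_log_neg_of_im_pos (w := u * (z - p)) (by
      rw [mul_sub, Complex.sub_im]; linarith)
    linear_combination -this

theorem exists_ge_of_forall_add {Q : ℝ → Prop} {s₀ δ : ℝ} (hδ : 0 < δ) (h0 : Q s₀)
    (hQ : ∀ s, Q s → Q (s + δ)) (M : ℝ) : ∃ s, M ≤ s ∧ Q s := by
  have h : ∀ n : ℕ, Q (s₀ + n * δ) := fun n => by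
    induction n with
    | zero => simpa using h0
    | succ n ih =>
      have := hQ _ ih
      rwa [show s₀ + ((n + 1 : ℕ) : ℝ) * δ = s₀ + n * δ + δ by push_cast; ring]
  obtain ⟨n, hn⟩ := exists_nat_ge ((M - s₀) / δ)
  refine ⟨_, ?_, h n⟩
  rw [div_le_iff₀ hδ] at hn
  linarith

theorem exists_bound_of_isCompact {K : Set ℂ} (hK : IsCompact K) {ℓ : ℂ → ℝ} (hℓ : Continuous ℓ) :
    ∃ m M, ∀ z ∈ K, m ≤ ℓ z ∧ ℓ z ≤ M := by
  obtain ⟨m, hm⟩ := (hK.image hℓ).bddBelow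
  obtain ⟨M, hM⟩ := (hK.image hℓ).bddAbove
  exact ⟨m, M, fun z hz => ⟨hm ⟨z, hz, rfl⟩, hM ⟨z, hz, rfl⟩⟩⟩

theorem HasLogModLinear.glue_of_hasLogOn {K : Set ℂ} (hK : IsCompact K) {u : ℂ} (hu : u ≠ 0)
    (c : ℝ) {f : ℂ → ℂ} (hL : HasLogOn f (K ∩ {z | (u * z).re ≤ c}))
    (hR : HasLogOn f (K ∩ {z | c ≤ (u * z).re})) : HasLogModLinear f K := by
  obtain ⟨g₁, hg₁, he₁⟩ := hL
  obtain ⟨g₂, hg₂, he₂⟩ := hR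
  set τ : ℂ := 2 * Real.pi * Complex.I with hτ
  have hcre : Continuous fun z : ℂ => (u * z).re := by fun_prop
  have hcim : Continuous fun z : ℂ => (u * z).im := by fun_prop
  have hclL : IsClosed (K ∩ {z | (u * z).re ≤ c}) :=
    hK.isClosed.inter (isClosed_le hcre continuous_const)
  have hclR : IsClosed (K ∩ {z | c ≤ (u * z).re}) :=
    hK.isClosed.inter (isClosed_le continuous_const hcre)
  set Λ : Set ℂ := K ∩ {z | (u * z).re = c}
  have hΛL : Λ ⊆ K ∩ {z | (u * z).re ≤ c} := fun z hz => ⟨hz.1, le_of_eq hz.2⟩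
  have hΛR : Λ ⊆ K ∩ {z | c ≤ (u * z).re} := fun z hz => ⟨hz.1, ge_of_eq hz.2⟩
  have hΛc : IsCompact Λ := hK.inter_right (isClosed_eq hcre continuous_const)
  have hdiff : ∀ z ∈ Λ, ∃ n : ℤ, g₁ z - g₂ z = n * τ := fun z hz => by
    obtain ⟨n, hn⟩ := Complex.exp_eq_exp_iff_exists_int.1
      ((he₁ z (hΛL hz)).trans (he₂ z (hΛR hz)).symm)
    exact ⟨n, by rw [hn]; ring⟩
  obtain ⟨δ, hδ, hunif⟩ := Metric.uniformContinuousOn_iff.1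
    (hΛc.uniformContinuousOn_of_continuous ((hg₁.mono hΛL).sub (hg₂.mono hΛR))) 1 one_pos
  -- on short pieces of the line the difference of the two logarithms is constant
  have hconst : ∀ z ∈ Λ, ∀ w ∈ Λ, |(u * z).im - (u * w).im| < δ * ‖u‖ →
      g₁ z - g₂ z = g₁ w - g₂ w := by
    intro z hz w hw h
    have hzw : dist z w < δ := by
      have h1 : u * (z - w) = ((u * z).im - (u * w).im : ℝ) * Complex.I := by
        apply Complex.ext
        · simp only [mul_sub, Complex.sub_re]
          rw [show (u * z).re = c from hz.2, show (u * w).re = c from hw.2]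
          simp
        · simp [mul_sub]
      have h2 := congrArg norm h1
      rw [norm_mul, norm_mul, Complex.norm_I, mul_one, Complex.norm_real, Real.norm_eq_abs] at h2
      rw [dist_eq_norm]
      have : 0 < ‖u‖ := norm_pos_iff.2 hu
      nlinarith
    have := hunif z hz w hw hzw
    obtain ⟨n, hn⟩ := hdiff z hz
    obtain ⟨m, hm⟩ := hdiff w hw
    simp only [Pi.sub_apply] at this
    rw [hn, hm] at this ⊢
    rw [dist_eq_norm, ← sub_mul, norm_mul] at this
    have hτn : 1 < ‖τ‖ := by
      rw [hτ]
      simp only [norm_mul, Complex.norm_I, Complex.norm_real, Real.norm_eq_abs,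
        abs_of_pos Real.pi_pos, Complex.norm_ofNat]
      linarith [Real.pi_gt_three]
    have h3 : ‖((n : ℂ) - m)‖ < 1 := by
      by_contra h4
      nlinarith [norm_nonneg ((n : ℂ) - m)]
    have h5 : ‖((n - m : ℤ) : ℂ)‖ < 1 := by push_cast; exact h3
    rw [Complex.norm_intCast] at h5
    have h6 : |n - m| < 1 := by exact_mod_cast h5
    rw [Int.abs_lt_one_iff] at h6
    rw [sub_eq_zero.1 h6]
  set Q : ℝ → Prop := fun s => ∃ r ∈ linearProducts K, ∃ a b : ℂ → ℂ, ∃ n : ℤ,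
    ContinuousOn a (K ∩ {z | (u * z).re ≤ c}) ∧
    (∀ z ∈ K ∩ {z | (u * z).re ≤ c}, Complex.exp (a z) = r z) ∧
    ContinuousOn b (K ∩ {z | c ≤ (u * z).re}) ∧
    (∀ z ∈ K ∩ {z | c ≤ (u * z).re}, Complex.exp (b z) = r z) ∧
    (∀ z ∈ Λ, (u * z).im ≤ s → g₁ z + a z = g₂ z + b z) ∧
    ∀ z ∈ Λ, s ≤ (u * z).im → a z - b z = n * τ with hQ
  obtain ⟨m, M, hmM⟩ := exists_bound_of_isCompact hK hcim
  have hu' : 0 < ‖u‖ := norm_pos_iff.2 hu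
  have hQ0 : Q (m - 1) := ⟨1, one_mem _, 0, 0, 0, continuousOn_const, by simp, continuousOn_const,
    by simp, fun z hz h => by linarith [(hmM z hz.1).1], by simp⟩
  have hstep : ∀ s, Q s → Q (s + δ * ‖u‖ / 2) := by
    rintro s ⟨r, hr, a, b, n, ha, hae, hb, hbe, hlo, hhi⟩
    have hδu : 0 < δ * ‖u‖ := by positivity
    by_cases hne : ∃ w ∈ Λ, s ≤ (u * w).im ∧ (u * w).im ≤ s + δ * ‖u‖ / 2
    swap
    · push Not at hne
      refine ⟨r, hr, a, b, n, ha, hae, hb, hbe, fun z hz h => ?_, fun z hz h => ?_⟩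
      · by_contra hcon
        have h1 : s < (u * z).im := by
          by_contra h2
          exact hcon (hlo z hz (not_lt.1 h2))
        exact absurd h (not_le.2 (hne z hz h1.le))
      · exact hhi z hz (by linarith)
    obtain ⟨w, hw, hw1, hw2⟩ := hne
    obtain ⟨k, hk⟩ := hdiff w hw
    have hloc : ∀ z ∈ Λ, s ≤ (u * z).im → (u * z).im ≤ s + δ * ‖u‖ / 2 →
        g₁ z - g₂ z = k * τ := fun z hz h1 h2 => by
      rw [← hk]
      exact hconst z hz w hw (abs_lt.2 ⟨by linarith, by linarith⟩)
    set p : ℂ := (c + s * Complex.I) / u with hp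
    have hup : u * p = c + s * Complex.I := by rw [hp]; field_simp
    have hpre : (u * p).re = c := by rw [hup]; simp
    have hpim : (u * p).im = s := by rw [hup]; simp
    by_cases hpK : p ∈ K
    · have hpΛ : p ∈ Λ := ⟨hpK, hpre⟩
      have h1 := hlo p hpΛ hpim.le
      have h2 := hhi p hpΛ hpim.ge
      have h3 := hloc p hpΛ hpim.ge (by rw [hpim]; linarith)
      refine ⟨r, hr, a, b, n, ha, hae, hb, hbe, fun z hz h => ?_, fun z hz h =>
        hhi z hz (by linarith)⟩
      rcases le_total (u * z).im s with h4 | h4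
      · exact hlo z hz h4
      · linear_combination hloc z hz h4 h + hhi z hz h4 - h2 - h3 + h1
    · obtain ⟨A, B, ⟨hA, hAe⟩, ⟨hB, hBe⟩, h0, h1⟩ := exists_log_pair hu p
      rw [hpre] at hA hB
      rw [hpim] at h0 h1
      have hKp : ∀ z ∈ K, z ≠ p := fun z hz h => hpK (h ▸ hz)
      have himne : ∀ z ∈ Λ, (u * z).im ≠ s := fun z hz h => by
        refine hKp z hz.1 (mul_left_cancel₀ hu (Complex.ext ?_ ?_))
        · rw [hpre]; exact hz.2
        · rw [hpim]; exact h
      refine ⟨r * fun z => (z - p) ^ (n + k), mul_mem hr (sub_zpow_mem_linearProducts hpK _),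
        fun z => a z + (n + k : ℤ) * A z, fun z => b z + (n + k : ℤ) * B z, -k,
        ha.add (continuousOn_const.mul (hA.mono fun z hz => ⟨hKp z hz.1, hz.2⟩)), ?_,
        hb.add (continuousOn_const.mul (hB.mono fun z hz => ⟨hKp z hz.1, hz.2⟩)), ?_, ?_, ?_⟩
      · intro z hz
        rw [Complex.exp_add, hae z hz, Complex.exp_int_mul, hAe z (hKp z hz.1)]
        rfl
      · intro z hz
        rw [Complex.exp_add, hbe z hz, Complex.exp_int_mul, hBe z (hKp z hz.1)]
        rfl
      · intro z hz h
        rcases lt_or_gt_of_ne (himne z hz) with h4 | h4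
        · linear_combination hlo z hz h4.le + ((n + k : ℤ) : ℂ) * h0 z h4
        · have := hloc z hz h4.le h
          have h5 := hhi z hz h4.le
          have h6 := h1 z h4
          push_cast
          linear_combination this + h5 + ((n : ℂ) + k) * h6
      · intro z hz h
        have h4 : s < (u * z).im := by linarith
        have h5 := hhi z hz h4.le
        have h6 := h1 z h4
        push_cast
        linear_combination h5 + ((n : ℂ) + k) * h6
  obtain ⟨s, hs, r, hr, a, b, n, ha, hae, hb, hbe, hlo, -⟩ :=
    exists_ge_of_forall_add (by positivity) hQ0 hstep M
  have hagree : ∀ z ∈ Λ, g₁ z + a z = g₂ z + b z := fun z hz =>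
    hlo z hz ((hmM z hz.1).2.trans hs)
  classical
  refine ⟨r, hr, fun z => if (u * z).re ≤ c then g₁ z + a z else g₂ z + b z, ?_, ?_⟩
  · have hcover : K = (K ∩ {z | (u * z).re ≤ c}) ∪ (K ∩ {z | c ≤ (u * z).re}) := by
      ext z
      constructor
      · intro hz
        exact (le_total (u * z).re c).imp (fun h => ⟨hz, h⟩) fun h => ⟨hz, h⟩
      · rintro (h | h) <;> exact h.1
    rw [hcover]
    refine ContinuousOn.union_of_isClosed ?_ ?_ hclL hclR
    · exact (hg₁.add ha).congr fun z hz => if_pos hz.2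
    · refine (hg₂.add hb).congr fun z hz => ?_
      split_ifs with h
      · exact hagree z ⟨hz.1, le_antisymm h hz.2⟩
      · rfl
  · intro z hz
    simp only
    split_ifs with h
    · rw [Complex.exp_add, he₁ z ⟨hz, h⟩, hae z ⟨hz, h⟩]
    · have h' := (not_le.1 h).le
      rw [Complex.exp_add, he₂ z ⟨hz, h'⟩, hbe z ⟨hz, h'⟩]

/-- A product of linear factors with zeros off one side of `K` can be traded for one with zeros
off `K` which has a logarithm on the other side. -/
theorem exists_linearProducts_of_inter {K L R : Set ℂ}
    (hout : ∀ p ∉ L, HasLogOn (fun z => z - p) (K ∩ L))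
    (hin : ∀ p ∈ L, p ∉ K → HasLogOn (fun z => z - p) (K ∩ R))
    {r : ℂ → ℂ} (hr : r ∈ linearProducts (K ∩ L)) :
    ∃ r' ∈ linearProducts K, HasLogOn (fun z => r z * (r' z)⁻¹) (K ∩ L) ∧
      HasLogOn r' (K ∩ R) := by
  induction hr using Submonoid.closure_induction with
  | mem r h =>
    obtain ⟨p, hp, m, rfl⟩ := h
    by_cases hpL : p ∈ L
    · have hpK : p ∉ K := fun h => hp ⟨h, hpL⟩
      refine ⟨_, sub_zpow_mem_linearProducts hpK m, ?_, (hin p hpL hpK).zpow m⟩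
      refine (HasLogOn.const one_ne_zero).congr fun z hz => ?_
      have : z - p ≠ 0 := sub_ne_zero.2 fun h => hpK (h ▸ hz.1)
      exact (mul_inv_cancel₀ (zpow_ne_zero m this)).symm
    · exact ⟨1, one_mem _, by simpa using (hout p hpL).zpow m, HasLogOn.const one_ne_zero⟩
  | one => exact ⟨1, one_mem _, by simpa using HasLogOn.const one_ne_zero,
      HasLogOn.const one_ne_zero⟩
  | mul x y _ _ hx hy =>
    obtain ⟨x', hx', h1, h2⟩ := hx
    obtain ⟨y', hy', h3, h4⟩ := hy
    refine ⟨x' * y', mul_mem hx' hy', (h1.mul h3).congr fun z _ => ?_, h2.mul h4⟩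
    simp only [Pi.mul_apply, mul_inv]
    ring

theorem HasLogModLinear.glue {K : Set ℂ} (hK : IsCompact K) {u : ℂ} (hu : u ≠ 0)
    (c : ℝ) {f : ℂ → ℂ} (hL : HasLogModLinear f (K ∩ {z | (u * z).re ≤ c}))
    (hR : HasLogModLinear f (K ∩ {z | c ≤ (u * z).re})) : HasLogModLinear f K := by
  obtain ⟨r₁, hr₁, h₁⟩ := hL
  obtain ⟨r₂, hr₂, h₂⟩ := hR
  obtain ⟨s₁, hs₁, h₁₁, h₁₂⟩ := exists_linearProducts_of_inter (R := {z | c ≤ (u * z).re})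
    (fun p hp => hasLogOn_sub_of_re_nonpos hu fun z hz => by
      have h1 : (u * z).re ≤ c := hz.2
      have h2 : c < (u * p).re := not_le.1 hp
      refine ⟨fun h => by rw [h] at h1; linarith, ?_⟩
      rw [mul_sub, Complex.sub_re]; linarith)
    (fun p hp hpK => hasLogOn_sub_of_re_nonneg hu fun z hz => by
      have h1 : c ≤ (u * z).re := hz.2
      have h2 : (u * p).re ≤ c := hp
      refine ⟨fun h => hpK (h ▸ hz.1), ?_⟩
      rw [mul_sub, Complex.sub_re]; linarith) hr₁
  obtain ⟨s₂, hs₂, h₂₁, h₂₂⟩ := exists_linearProducts_of_inter (R := {z | (u * z).re ≤ c})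
    (fun p hp => hasLogOn_sub_of_re_nonneg hu fun z hz => by
      have h1 : c ≤ (u * z).re := hz.2
      have h2 : (u * p).re < c := not_le.1 hp
      refine ⟨fun h => by rw [h] at h1; linarith, ?_⟩
      rw [mul_sub, Complex.sub_re]; linarith)
    (fun p hp hpK => hasLogOn_sub_of_re_nonpos hu fun z hz => by
      have h1 : (u * z).re ≤ c := hz.2
      have h2 : c ≤ (u * p).re := hp
      refine ⟨fun h => hpK (h ▸ hz.1), ?_⟩
      rw [mul_sub, Complex.sub_re]; linarith) hr₂
  obtain ⟨r, hr, h⟩ := HasLogModLinear.glue_of_hasLogOn hK hu c (f := fun z => f z * s₁ z * s₂ z)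
    (((h₁.mul h₁₁.inv).mul h₂₂).congr fun z hz => by
      have := (mul_ne_zero_iff.1 (h₁.ne_zero hz)).2
      have h' := h₁₁.ne_zero hz
      simp only [mul_inv, inv_inv]
      field_simp)
    (((h₂.mul h₂₁.inv).mul h₁₂).congr fun z hz => by
      have := (mul_ne_zero_iff.1 (h₂.ne_zero hz)).2
      simp only [mul_inv, inv_inv]
      field_simp)
  refine ⟨s₁ * s₂ * r, mul_mem (mul_mem hs₁ hs₂) hr, h.congr fun z _ => ?_⟩
  simp only [Pi.mul_apply]
  ring

theorem HasLogOn.hasLogModLinear {K : Set ℂ} {f : ℂ → ℂ} (h : HasLogOn f K) :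
    HasLogModLinear f K :=
  ⟨1, one_mem _, by simpa using h⟩

theorem HasLogModLinear.of_strips {K : Set ℂ} (hK : IsCompact K) {u : ℂ} (hu : u ≠ 0)
    {f : ℂ → ℂ} {δ : ℝ} (hδ : 0 < δ)
    (h : ∀ c, HasLogModLinear f (K ∩ {z | c ≤ (u * z).re ∧ (u * z).re ≤ c + δ})) :
    HasLogModLinear f K := by
  have hcre : Continuous fun z : ℂ => (u * z).re := by fun_prop
  obtain ⟨m, M, hmM⟩ := exists_bound_of_isCompact hK hcre
  obtain ⟨s, hs, hfs⟩ := exists_ge_of_forall_add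
    (Q := fun c => HasLogModLinear f (K ∩ {z | (u * z).re ≤ c})) (s₀ := m - 1) hδ
    (by
      have : K ∩ {z | (u * z).re ≤ m - 1} = ∅ := by
        ext z
        simp only [Set.mem_inter_iff, Set.mem_ofPred_eq, Set.mem_empty_iff_false, iff_false,
          not_and, not_le]
        intro hz
        linarith [(hmM z hz).1]
      rw [this]
      exact HasLogOn.empty.hasLogModLinear)
    (fun c hc => by
      refine HasLogModLinear.glue (hK.inter_right (isClosed_le hcre continuous_const)) hu c ?_ ?_
      · convert hc using 1
        ext z
        simp only [Set.mem_inter_iff, Set.mem_ofPred_eq]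
        constructor
        · rintro ⟨⟨h1, h2⟩, h3⟩; exact ⟨h1, h3⟩
        · rintro ⟨h1, h3⟩; exact ⟨⟨h1, by linarith⟩, h3⟩
      · convert h c using 1
        ext z
        simp only [Set.mem_inter_iff, Set.mem_ofPred_eq]
        tauto) M
  convert hfs using 1
  ext z
  simp only [Set.mem_inter_iff, Set.mem_ofPred_eq]
  exact ⟨fun hz => ⟨hz, (hmM z hz).2.trans hs⟩, And.left⟩

theorem hasLogModLinear_of_continuousOn {K : Set ℂ} (hK : IsCompact K) {f : ℂ → ℂ}
    (hf : ContinuousOn f K) (h0 : ∀ z ∈ K, f z ≠ 0) : HasLogModLinear f K := by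
  obtain ⟨ε, hε, hεf⟩ : ∃ ε > 0, ∀ z ∈ K, ε ≤ ‖f z‖ := by
    rcases K.eq_empty_or_nonempty with rfl | hne
    · exact ⟨1, one_pos, by simp⟩
    · obtain ⟨z, hz, hmin⟩ := hK.exists_isMinOn hne hf.norm
      exact ⟨‖f z‖, norm_pos_iff.2 (h0 z hz), fun w hw => hmin hw⟩
  obtain ⟨δ, hδ, hunif⟩ := Metric.uniformContinuousOn_iff.1
    (hK.uniformContinuousOn_of_continuous hf) ε hε
  have h3 : 0 < δ / 3 := by positivity
  refine .of_strips hK one_ne_zero h3 fun c => ?_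
  have hcre : Continuous fun z : ℂ => (1 * z).re := by fun_prop
  refine .of_strips (u := -Complex.I) (hK.inter_right ((isClosed_le continuous_const hcre).inter
    (isClosed_le hcre continuous_const))) (by simp) h3 fun d => HasLogOn.hasLogModLinear ?_
  set S := _ ∩ {z : ℂ | d ≤ (-Complex.I * z).re ∧ (-Complex.I * z).re ≤ d + δ / 3}
  have hSK : S ⊆ K := fun z hz => hz.1.1
  rcases S.eq_empty_or_nonempty with he | ⟨w, hw⟩
  · rw [he]
    exact HasLogOn.empty
  have hlog : HasLogOn (fun z => f z / f w) S := by
    refine .of_norm_sub_one_lt ((hf.mono hSK).div_const _) fun z hz => ?_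
    have hfw := h0 w (hSK hw)
    have : dist z w < δ := by
      obtain ⟨⟨-, h1 : c ≤ (1 * z).re, h2 : (1 * z).re ≤ _⟩, h4, h5⟩ := hz
      obtain ⟨⟨-, h6 : c ≤ (1 * w).re, h7 : (1 * w).re ≤ _⟩, h8, h9⟩ := hw
      simp only [one_mul, neg_mul, Complex.neg_re, Complex.mul_re, Complex.I_re, zero_mul,
        Complex.I_im, zero_sub, neg_neg] at h1 h2 h4 h5 h6 h7 h8 h9
      rw [dist_eq_norm]
      refine (Complex.norm_le_abs_re_add_abs_im _).trans_lt ?_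
      have e1 : |(z - w).re| ≤ δ / 3 := by
        rw [Complex.sub_re, abs_le]; constructor <;> linarith
      have e2 : |(z - w).im| ≤ δ / 3 := by
        rw [Complex.sub_im, abs_le]; constructor <;> linarith
      linarith
    have := hunif z (hSK hz) w (hSK hw) this
    rw [dist_eq_norm] at this
    rw [div_sub_one hfw, norm_div, div_lt_one (norm_pos_iff.2 hfw)]
    exact this.trans_le (hεf w (hSK hw))
  refine (hlog.mul (.const (h0 w (hSK hw)))).congr fun z _ => ?_
  have hfw := h0 w (hSK hw)
  field_simp

/-- Moving the pole `p` inside a connected set that misses the compact set `K` does not change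
the homotopy class of `z - p` on `K`. -/
theorem hasLogOn_sub_div_sub {K F : Set ℂ} (hK : IsCompact K) (hF : IsPreconnected F)
    (hd : Disjoint F K) {p q : ℂ} (hp : p ∈ F) (hq : q ∈ F) :
    HasLogOn (fun z => (z - p) / (z - q)) K := by
  have hne : ∀ p ∈ F, ∀ z ∈ K, z - p ≠ 0 := fun p hp z hz =>
    sub_ne_zero.2 fun h => Set.disjoint_left.1 hd hp (h ▸ hz)
  refine hF.induction₂ (fun p q => HasLogOn (fun z => (z - p) / (z - q)) K) ?_ ?_ ?_ hp hq
  · intro p hp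
    have hpK : p ∈ Kᶜ := Set.disjoint_left.1 hd hp
    obtain ⟨ε, hε, hb⟩ := Metric.isOpen_iff.1 hK.isClosed.isOpen_compl p hpK
    refine Filter.Eventually.filter_mono nhdsWithin_le_nhds ?_
    filter_upwards [Metric.ball_mem_nhds p hε] with q hq
    have h1 : HasLogOn (fun z => (z - q) / (z - p)) K := by
      refine .of_norm_sub_one_lt (ContinuousOn.div (by fun_prop) (by fun_prop) (hne p hp))
        fun z hz => ?_
      have h2 := hne p hp z hz
      rw [div_sub_one h2, norm_div, div_lt_one (norm_pos_iff.2 h2)]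
      have h3 : ε ≤ ‖z - p‖ := by
        by_contra h4
        refine hb (?_ : z ∈ _) hz
        rw [Metric.mem_ball, dist_eq_norm]
        exact not_le.1 h4
      refine lt_of_lt_of_le ?_ h3
      rw [Metric.mem_ball, dist_eq_norm] at hq
      rw [show z - q - (z - p) = -(q - p) by ring, norm_neg]
      exact hq
    exact h1.inv.congr fun z _ => inv_div _ _
  · intro x y z hx hy hz h1 h2
    refine (h1.mul h2).congr fun w hw => ?_
    have := hne y hy w hw
    field_simp
  · intro x y _ _ h
    exact h.inv.congr fun z _ => inv_div _ _

theorem hasLogOn_sub_of_lt_norm {K : Set ℂ} {R : ℝ} (hK : K ⊆ Metric.closedBall 0 R) {p : ℂ}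
    (hp : R < ‖p‖) (hR : 0 ≤ R) : HasLogOn (fun z => z - p) K := by
  have hp0 : p ≠ 0 := norm_pos_iff.1 (hR.trans_lt hp)
  have h1 : HasLogOn (fun z => (z - p) / -p) K := by
    refine .of_norm_sub_one_lt (by fun_prop) fun z hz => ?_
    rw [div_sub_one (neg_ne_zero.2 hp0), norm_div, norm_neg,
      div_lt_one (norm_pos_iff.2 hp0), sub_neg_eq_add, sub_add_cancel]
    exact (mem_closedBall_zero_iff.1 (hK hz)).trans_lt hp
  refine (h1.mul (.const (neg_ne_zero.2 hp0))).congr fun z _ => ?_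
  field_simp

theorem eq_zero_of_hasLogOn_zpow_sphere {R : ℝ} (hR : 0 < R) {n : ℤ}
    (h : HasLogOn (fun z => z ^ n) (Metric.sphere (0 : ℂ) R)) : n = 0 := by
  obtain ⟨g, hg, he⟩ := h
  have hmem : ∀ t : ℝ, (R * Complex.exp (t * Complex.I) : ℂ) ∈ Metric.sphere (0 : ℂ) R := by
    intro t
    simp [Complex.norm_exp_ofReal_mul_I, abs_of_pos hR]
  have hcont : Continuous fun t : ℝ => g (R * Complex.exp (t * Complex.I)) := by
    rw [← continuousOn_univ]
    exact hg.comp (by fun_prop) fun t _ => hmem t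
  have hR0 : (R : ℂ) ≠ 0 := by exact_mod_cast hR.ne'
  have := sub_eq_sub_of_exp_eq (X := ℝ) isPreconnected_univ hcont.continuousOn
    (b := fun t => n * (Complex.log R + t * Complex.I)) (by fun_prop)
    (fun t _ => by
      rw [he _ (hmem t), Complex.exp_int_mul, Complex.exp_add, Complex.exp_log hR0])
    (Set.mem_univ 0) (Set.mem_univ (2 * Real.pi))
  simp only [Complex.ofReal_zero, zero_mul, Complex.exp_zero, Complex.ofReal_mul,
    Complex.ofReal_ofNat, Complex.exp_two_pi_mul_I] at this
  have h2 : (n : ℂ) * (2 * Real.pi * Complex.I) = 0 := by linear_combination this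
  simpa [Complex.two_pi_I_ne_zero] using h2

/-- Eilenberg's criterion for a compact set `K` in a disc whose complement is covered by a
connected set `F` and the exterior of the disc. -/
theorem hasLogOn_of_isPreconnected_compl {K F : Set ℂ} {R : ℝ} (hR : 0 < R) (hK : IsCompact K)
    (hKR : K ⊆ Metric.closedBall 0 R) (hF : IsPreconnected F) (hFne : F.Nonempty)
    (hd : Disjoint F K) (hcover : ∀ p ∉ K, p ∈ F ∨ R < ‖p‖)
    {f : ℂ → ℂ} (hf : ContinuousOn f K) (h0 : ∀ z ∈ K, f z ≠ 0)
    (hsphere : (∃ p ∈ F, R < ‖p‖) ∨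
      (F ⊆ Metric.ball 0 R ∧ HasLogOn f (Metric.sphere 0 R))) :
    HasLogOn f K := by
  obtain ⟨q, hq, hq'⟩ : ∃ q ∈ F, R < ‖q‖ ∨
      (F ⊆ Metric.ball 0 R ∧ HasLogOn f (Metric.sphere 0 R)) := by
    rcases hsphere with ⟨q, hq, h⟩ | h
    · exact ⟨q, hq, Or.inl h⟩
    · exact ⟨hFne.some, hFne.some_mem, Or.inr h⟩
  have hne : ∀ z ∈ K, z - q ≠ 0 := fun z hz =>
    sub_ne_zero.2 fun h => Set.disjoint_left.1 hd hq (h ▸ hz)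
  have key : ∀ r ∈ linearProducts K, ∃ n : ℤ, HasLogOn (fun z => r z * (z - q) ^ n) K := by
    intro r hr
    induction hr using Submonoid.closure_induction with
    | mem r h =>
      obtain ⟨p, hp, m, rfl⟩ := h
      rcases hcover p hp with h | h
      · refine ⟨-m, ((hasLogOn_sub_div_sub hK hF hd h hq).zpow m).congr fun z _ => ?_⟩
        rw [div_zpow, zpow_neg, div_eq_mul_inv]
      · exact ⟨0, by simpa using (hasLogOn_sub_of_lt_norm hKR h hR.le).zpow m⟩
    | one => exact ⟨0, by simpa using HasLogOn.const one_ne_zero⟩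
    | mul x y _ _ hx hy =>
      obtain ⟨m, hm⟩ := hx
      obtain ⟨n, hn⟩ := hy
      refine ⟨m + n, (hm.mul hn).congr fun z hz => ?_⟩
      rw [zpow_add₀ (hne z hz), Pi.mul_apply]
      ring
  obtain ⟨r, hr, hfr⟩ := hasLogModLinear_of_continuousOn hK hf h0
  obtain ⟨n, hn⟩ := key r hr
  have h1 : HasLogOn (fun z => f z * ((z - q) ^ n)⁻¹) K :=
    (hfr.mul hn.inv).congr fun z hz => by
      have := (mul_ne_zero_iff.1 (hfr.ne_zero hz)).2
      rw [mul_inv]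
      field_simp
  have h2 : HasLogOn (fun z => (z - q) ^ n) K := by
    rcases hq' with h | ⟨h, hs⟩
    · exact (hasLogOn_sub_of_lt_norm hKR h hR.le).zpow n
    · have hsK : Metric.sphere (0 : ℂ) R ⊆ K := fun z hz => by
        by_contra hzK
        have hz' := mem_sphere_zero_iff_norm.1 hz
        rcases hcover z hzK with h3 | h3
        · exact (mem_ball_zero_iff.1 (h h3)).ne hz'
        · exact h3.ne' hz'
      have hz0 : ∀ z ∈ Metric.sphere (0 : ℂ) R, z ≠ 0 := fun z hz =>
        norm_pos_iff.1 (by rw [mem_sphere_zero_iff_norm.1 hz]; exact hR)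
      have h4 : HasLogOn (fun z => (z - q) / z) (Metric.sphere (0 : ℂ) R) := by
        refine .of_norm_sub_one_lt (ContinuousOn.div (by fun_prop) (by fun_prop) hz0)
          fun z hz => ?_
        rw [div_sub_one (hz0 z hz), norm_div, div_lt_one (norm_pos_iff.2 (hz0 z hz)),
          sub_sub_cancel_left, norm_neg, mem_sphere_zero_iff_norm.1 hz]
        exact mem_ball_zero_iff.1 (h hq)
      have h5 : HasLogOn (fun z => z ^ n) (Metric.sphere (0 : ℂ) R) :=
        ((hs.mul (h1.mono hsK).inv).mul (h4.zpow n).inv).congr fun z hz => by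
          have e1 := hs.ne_zero hz
          have e2 := zpow_ne_zero n (hne z (hsK hz))
          have e3 := zpow_ne_zero n (hz0 z hz)
          simp only [div_zpow, mul_inv, inv_inv, inv_div]
          field_simp
      rw [eq_zero_of_hasLogOn_zpow_sphere hR h5]
      simpa using HasLogOn.const one_ne_zero
  exact (h1.mul h2).congr fun z hz => by
    have := zpow_ne_zero n (hne z hz)
    field_simp

/-- A set `A` obtained from a closed subset of `D` by adding components of `Dᶜ` with frontier in
that subset is closed, provided a component meeting `A` lies in `A`. -/
theorem isClosed_union_components {E : Type*} [NormedAddCommGroup E] [NormedSpace ℝ E]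
    {D C A : Set E} (hD : IsClosed D) (hC : IsClosed C) (hCA : C ⊆ A) (hAD : A ∩ D ⊆ C)
    (hcomp : ∀ z ∈ A, z ∉ D → connectedComponentIn Dᶜ z ⊆ A ∧
      frontier (connectedComponentIn Dᶜ z) ⊆ C) :
    IsClosed A := by
  refine isClosed_of_closure_subset fun x hx => ?_
  by_cases hxD : x ∈ D
  · refine hCA (hC.closure_subset (Metric.mem_closure_iff.2 fun ε hε => ?_))
    obtain ⟨y, hy, hxy⟩ := Metric.mem_closure_iff.1 hx ε hε
    by_cases hyD : y ∈ D
    · exact ⟨y, hAD ⟨hy, hyD⟩, hxy⟩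
    set F := connectedComponentIn Dᶜ y
    have hFo : IsOpen F := hD.isOpen_compl.connectedComponentIn
    have hyF : y ∈ F := mem_connectedComponentIn hyD
    by_contra hcon
    have hsub : Metric.ball x ε ⊆ F := by
      refine IsPreconnected.subset_left_of_subset_union hFo isClosed_closure.isOpen_compl
        (Set.disjoint_compl_right_iff_subset.2 subset_closure) (fun z hz => ?_)
        ⟨y, Metric.mem_ball'.2 hxy, hyF⟩ (convex_ball x ε).isPreconnected
      by_contra hz'
      simp only [Set.mem_union, Set.mem_compl_iff, not_or, not_not] at hz'
      refine hcon ⟨z, (hcomp y hy hyD).2 ⟨hz'.2, ?_⟩, Metric.mem_ball'.1 hz⟩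
      rw [hFo.interior_eq]
      exact hz'.1
    exact connectedComponentIn_subset _ _ (hsub (Metric.mem_ball_self hε)) hxD
  · have hFo : IsOpen (connectedComponentIn Dᶜ x) := hD.isOpen_compl.connectedComponentIn
    obtain ⟨y, hyF, hyA⟩ := mem_closure_iff.1 hx _ hFo (mem_connectedComponentIn hxD)
    have hyD : y ∉ D := connectedComponentIn_subset _ _ hyF
    refine (hcomp y hyA hyD).1 ?_
    rw [← connectedComponentIn_eq hyF]
    exact mem_connectedComponentIn hxD

/-- A nonvanishing function on a plane compactum `D` that has a logarithm, extendable to the whole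
plane, along the frontier of every complementary component but one has a logarithm on `D`. -/
theorem hasLogOn_of_hasLogOn_frontiers {ι : Type*} [Finite ι] [Nonempty ι] {D F : Set (ℝ × ℝ)}
    (hD : IsCompact D) (hF : ∃ x ∈ Dᶜ, F = connectedComponentIn Dᶜ x) {f : ℝ × ℝ → ℂ}
    (hf : ContinuousOn f D) (h0 : ∀ z ∈ D, f z ≠ 0) {g : ι → ℝ × ℝ → ℂ}
    (hg : ∀ i, Continuous (g i))
    (hfr : ∀ F', (∃ x ∈ Dᶜ, F' = connectedComponentIn Dᶜ x) → F' ≠ F →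
      ∃ i, ∀ z ∈ frontier F', z ∈ D ∧ f z = Complex.exp (g i z)) :
    HasLogOn f D := by
  classical
  obtain ⟨x₀, hx₀, hFx⟩ := hF
  have hFo : IsOpen F := hFx ▸ hD.isClosed.isOpen_compl.connectedComponentIn
  have hFc : IsPreconnected F := hFx ▸ isPreconnected_connectedComponentIn
  have hFD : F ⊆ Dᶜ := hFx ▸ connectedComponentIn_subset _ _
  have hFne : F.Nonempty := ⟨x₀, hFx ▸ mem_connectedComponentIn hx₀⟩
  have hcompF : ∀ z ∈ Dᶜ, connectedComponentIn Dᶜ z = F ↔ z ∈ F := fun z hz =>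
    ⟨fun h => h ▸ mem_connectedComponentIn hz, fun h => by
      rw [hFx] at h ⊢
      exact (connectedComponentIn_eq h).symm⟩
  have hfr' : ∀ F', ∃ i, (∃ x ∈ Dᶜ, F' = connectedComponentIn Dᶜ x) → F' ≠ F →
      ∀ z ∈ frontier F', z ∈ D ∧ f z = Complex.exp (g i z) := fun F' => by
    by_cases h : (∃ x ∈ Dᶜ, F' = connectedComponentIn Dᶜ x) ∧ F' ≠ F
    · obtain ⟨i, hi⟩ := hfr F' h.1 h.2
      exact ⟨i, fun _ _ => hi⟩
    · exact ⟨Classical.arbitrary ι, fun h1 h2 => absurd ⟨h1, h2⟩ h⟩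
  choose c hc using hfr'
  set k : ℝ × ℝ → ι := fun z => c (connectedComponentIn Dᶜ z) with hk
  set f' : ℝ × ℝ → ℂ := fun z => if z ∈ D then f z else Complex.exp (g (k z) z) with hf'
  have hf'D : ∀ z ∈ D, f' z = f z := fun z hz => if_pos hz
  have hf'0 : ∀ z, f' z ≠ 0 := fun z => by
    simp only [hf']
    split_ifs with h
    · exact h0 z h
    · exact Complex.exp_ne_zero _
  set C : ι → Set (ℝ × ℝ) := fun i => {z ∈ D | f z - Complex.exp (g i z) = 0}
  have hC : ∀ i, IsClosed (C i) := fun i =>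
    (hf.sub (Complex.continuous_exp.comp (hg i)).continuousOn).preimage_isClosed_of_isClosed
      hD.isClosed isClosed_singleton
  set A : ι → Set (ℝ × ℝ) := fun i => C i ∪ {z | z ∉ D ∧ z ∉ F ∧ k z = i}
  have hA : ∀ i, IsClosed (A i) := fun i => by
    refine isClosed_union_components hD.isClosed (hC i) Set.subset_union_left ?_ ?_
    · rintro z ⟨h | h, hzD⟩
      · exact h
      · exact absurd hzD h.1
    · rintro z (h | ⟨-, hzF, hzi⟩) hzD
      · exact absurd h.1 hzD
      have hzne : connectedComponentIn Dᶜ z ≠ F := fun h => hzF ((hcompF z hzD).1 h)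
      refine ⟨fun y hy => Or.inr ?_, fun y hy => ?_⟩
      · have hyD : y ∈ Dᶜ := connectedComponentIn_subset _ _ hy
        have heq := connectedComponentIn_eq hy
        refine ⟨hyD, fun h => hzne (heq.trans ((hcompF y hyD).2 h)), ?_⟩
        rw [← hzi]
        simp only [hk, heq]
      · have := hc _ ⟨z, hzD, rfl⟩ hzne y hy
        rw [show c (connectedComponentIn Dᶜ z) = i from hzi] at this
        exact ⟨this.1, sub_eq_zero.2 this.2⟩
  have hcontA : ∀ i, ContinuousOn f' (A i) := fun i => by
    refine (Complex.continuous_exp.comp (hg i)).continuousOn.congr ?_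
    rintro z (h | ⟨hzD, -, hzi⟩)
    · rw [hf'D z h.1]
      exact sub_eq_zero.1 h.2
    · simp only [hf', if_neg hzD, hzi, Function.comp]
  have hcont : ContinuousOn f' Fᶜ := by
    have h1 : ContinuousOn f' (D ∪ ⋃ i, A i) :=
      (hf.congr hf'D).union_of_isClosed
        ((locallyFinite_of_finite A).continuousOn_iUnion hA hcontA) hD.isClosed
        (isClosed_iUnion_of_finite hA)
    refine h1.mono fun z hz => ?_
    by_cases hzD : z ∈ D
    · exact Or.inl hzD
    · exact Or.inr (Set.mem_iUnion.2 ⟨k z, Or.inr ⟨hzD, hz, rfl⟩⟩)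
  set e : ℂ ≃L[ℝ] ℝ × ℝ := Complex.equivRealProdCLM
  obtain ⟨R₀, hR₀⟩ := (hD.image e.symm.continuous).isBounded.subset_closedBall 0
  have hlog : ∀ R, 0 < R → R₀ ≤ R → ((∃ p ∈ e ⁻¹' F, R < ‖p‖) ∨ (e ⁻¹' F ⊆ Metric.ball 0 R ∧
      HasLogOn (f' ∘ e) (Metric.sphere 0 R))) → HasLogOn f D := by
    intro R hR hR₀R h
    have hK : IsCompact (e ⁻¹' Fᶜ ∩ Metric.closedBall 0 R) :=
      (isCompact_closedBall 0 R).inter_left (hFo.isClosed_compl.preimage e.continuous)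
    have himg : e ⁻¹' F = e.symm '' F := (e.symm.image_eq_preimage_symm F).symm
    obtain ⟨a, ha, hea⟩ := hasLogOn_of_isPreconnected_compl (F := e ⁻¹' F) hR hK
      Set.inter_subset_right
      (himg ▸ hFc.image _ e.symm.continuous.continuousOn) (himg ▸ hFne.image _)
      (Set.disjoint_left.2 fun z hz hz' => hz'.1 hz)
      (fun p hp => by
        by_contra hcon
        push Not at hcon
        exact hp ⟨hcon.1, mem_closedBall_zero_iff.2 hcon.2⟩)
      (hcont.comp e.continuous.continuousOn fun z hz => hz.1) (fun z _ => hf'0 _) h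
    have hmaps : Set.MapsTo e.symm D (e ⁻¹' Fᶜ ∩ Metric.closedBall 0 R) := fun z hz =>
      ⟨by
        rw [Set.mem_preimage, e.apply_symm_apply]
        exact fun h => hFD h hz,
        Metric.closedBall_subset_closedBall hR₀R (hR₀ ⟨z, hz, rfl⟩)⟩
    refine ⟨a ∘ e.symm, ha.comp e.symm.continuous.continuousOn hmaps, fun z hz => ?_⟩
    rw [Function.comp, hea _ (hmaps hz), Function.comp, e.apply_symm_apply, hf'D z hz]
  by_cases hbig : ∃ p ∈ e ⁻¹' F, |R₀| + 1 < ‖p‖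
  · exact hlog (|R₀| + 1) (by positivity) (by linarith [le_abs_self R₀]) (Or.inl hbig)
  · push Not at hbig
    refine hlog (|R₀| + 2) (by positivity) (by linarith [le_abs_self R₀])
      (Or.inr ⟨fun p hp => ?_, ?_⟩)
    · rw [mem_ball_zero_iff]
      linarith [hbig p hp]
    set S := Metric.sphere (0 : ℂ) (|R₀| + 2)
    have hSc : IsPreconnected (e '' S) :=
      (isPreconnected_sphere (by simp [Complex.rank_real_complex]) 0 _).image _
        e.continuous.continuousOn
    have hSD : e '' S ⊆ Dᶜ := by
      rintro _ ⟨z, hz, rfl⟩ hzD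
      have h1 := hR₀ ⟨e z, hzD, rfl⟩
      rw [e.symm_apply_apply, mem_closedBall_zero_iff, mem_sphere_zero_iff_norm.1 hz] at h1
      linarith [le_abs_self R₀]
    obtain ⟨w, hw⟩ : S.Nonempty := (NormedSpace.sphere_nonempty (x := 0)).2 (by positivity)
    have hsub := hSc.subset_connectedComponentIn ⟨w, hw, rfl⟩ hSD
    refine ⟨fun z => g (k (e w)) (e z), ((hg _).comp e.continuous).continuousOn, fun z hz => ?_⟩
    have hzD : e z ∉ D := hSD ⟨z, hz, rfl⟩
    simp only [Function.comp, hf', if_neg hzD]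
    rw [show k (e w) = k (e z) from congrArg c (connectedComponentIn_eq (hsub ⟨z, hz, rfl⟩))]

namespace GraphEmbeddingIn

/-- The closed arc that represents a dart. -/
def dartArc (E : GraphEmbeddingIn X G) (d : G.Dart) : Set X :=
  E.edgeArc d.fst d.snd d.adj '' Set.Icc 0 1

variable (E : GraphEmbeddingIn X G)

theorem isCompact_dartArc (d : G.Dart) : IsCompact (E.dartArc d) :=
  isCompact_Icc.image_of_continuousOn (E.arc_cont _ _ _)

theorem isPreconnected_dartArc (d : G.Dart) : IsPreconnected (E.dartArc d) :=
  isPreconnected_Icc.image _ (E.arc_cont _ _ _)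

theorem vertexPos_fst_mem (d : G.Dart) : E.vertexPos d.fst ∈ E.dartArc d :=
  ⟨0, by simp, E.arc_start _ _ _⟩

theorem vertexPos_snd_mem (d : G.Dart) : E.vertexPos d.snd ∈ E.dartArc d :=
  ⟨1, by simp, E.arc_end _ _ _⟩

theorem dartArc_subset_drawing (d : G.Dart) : E.dartArc d ⊆ E.drawing := fun _ hz =>
  Or.inr (Set.mem_iUnion.2 ⟨d.fst, Set.mem_iUnion.2 ⟨d.snd, Set.mem_iUnion.2 ⟨d.adj, hz⟩⟩⟩)

theorem exists_dartArc_of_mem_drawing {z : X} (hz : z ∈ E.drawing) :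
    z ∈ Set.range E.vertexPos ∨ ∃ d, z ∈ E.dartArc d := by
  refine hz.imp_right fun h => ?_
  simp only [Set.mem_iUnion] at h
  obtain ⟨u, v, h, hz⟩ := h
  exact ⟨⟨(u, v), h⟩, hz⟩

theorem finite_dart [Finite V] : Finite G.Dart :=
  Finite.of_injective _ SimpleGraph.Dart.toProd_injective

theorem drawing_eq_iUnion :
    E.drawing = ⋃ i : G.Dart ⊕ V, Sum.elim E.dartArc (fun v => {E.vertexPos v}) i := by
  ext z
  simp only [Set.mem_iUnion, Sum.exists, Sum.elim_inl, Sum.elim_inr, Set.mem_singleton_iff]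
  constructor
  · intro h
    rcases E.exists_dartArc_of_mem_drawing h with ⟨v, hv⟩ | h
    · exact Or.inr ⟨v, hv.symm⟩
    · exact Or.inl h
  · rintro (⟨d, h⟩ | ⟨v, hv⟩)
    · exact E.dartArc_subset_drawing d h
    · exact Or.inl ⟨v, hv.symm⟩

theorem isCompact_drawing [Finite V] : IsCompact E.drawing := by
  have := finite_dart (G := G)
  rw [drawing_eq_iUnion]
  refine isCompact_iUnion fun i => ?_
  rcases i with d | v
  · exact E.isCompact_dartArc d
  · exact isCompact_singleton

/-- A common point of the arcs of two distinct edges is an end of the first edge. -/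
theorem exists_vertex_of_mem_dartArc {d d' : G.Dart} (h : d.edge ≠ d'.edge) {z : X}
    (hz : z ∈ E.dartArc d) (hz' : z ∈ E.dartArc d') :
    z = E.vertexPos d.fst ∨ z = E.vertexPos d.snd := by
  obtain ⟨t, ht, rfl⟩ := hz
  rcases ht.1.eq_or_lt with h0 | h0
  · exact Or.inl (by rw [← h0, E.arc_start])
  rcases ht.2.eq_or_lt with h1 | h1
  · exact Or.inr (by rw [h1, E.arc_end])
  have := E.arc_disjoint d.fst d.snd d.adj d'.fst d'.snd d'.adj h
  exact (Set.eq_empty_iff_forall_notMem.1 this _ ⟨⟨t, ⟨h0, h1⟩, rfl⟩, hz'⟩).elim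

/-- Functions prescribed on the edges, compatibly at the vertices, glue to a continuous function on
the drawing, with a default value off the edges. -/
theorem exists_continuousOn_drawing [Finite V] [T2Space X] {Y : Type*} [TopologicalSpace Y]
    (y₀ : Y) (val : V → V → X → Y) (b : V → Y)
    (hcont : ∀ u v, G.Adj u v → Continuous (val u v))
    (hsymm : ∀ u v, G.Adj u v → val u v = val v u)
    (hb : ∀ u v, G.Adj u v → val u v (E.vertexPos u) = b u) :
    ∃ g : X → Y, ContinuousOn g E.drawing ∧
      (∀ d : G.Dart, ∀ z ∈ E.dartArc d, g z = val d.fst d.snd z) ∧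
      ∀ z, (∀ d, z ∉ E.dartArc d) → g z = y₀ := by
  classical
  have hend : ∀ d : G.Dart, ∀ w, E.vertexPos w = E.vertexPos d.fst ∨
      E.vertexPos w = E.vertexPos d.snd → val d.fst d.snd (E.vertexPos w) = b w := by
    rintro d w (h | h)
    · rw [E.vertexInj h]
      exact hb _ _ d.adj
    · rw [E.vertexInj h, hsymm _ _ d.adj]
      exact hb _ _ d.adj.symm
  have hval : ∀ d d' : G.Dart, ∀ z ∈ E.dartArc d, z ∈ E.dartArc d' →
      val d.fst d.snd z = val d'.fst d'.snd z := by
    intro d d' z hz hz'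
    by_cases h : d.edge = d'.edge
    · rcases SimpleGraph.dart_edge_eq_iff d d' |>.1 h with rfl | rfl
      · rfl
      · exact congrFun (hsymm _ _ d'.adj).symm z
    · have h1 := E.exists_vertex_of_mem_dartArc h hz hz'
      have h2 := E.exists_vertex_of_mem_dartArc (Ne.symm h) hz' hz
      obtain ⟨w, rfl⟩ : ∃ w, z = E.vertexPos w := by
        rcases h1 with h1 | h1 <;> exact ⟨_, h1⟩
      rw [hend d w h1, hend d' w h2]
  refine ⟨fun z => if h : ∃ d, z ∈ E.dartArc d then val h.choose.fst h.choose.snd z else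
    y₀, ?_, ?_, fun z hz => dif_neg (not_exists.2 hz)⟩
  swap
  · intro d z hz
    have h : ∃ d, z ∈ E.dartArc d := ⟨d, hz⟩
    exact (dif_pos h).trans (hval _ _ z h.choose_spec hz)
  · have := finite_dart (G := G)
    rw [drawing_eq_iUnion]
    refine (locallyFinite_of_finite _).continuousOn_iUnion (fun i => ?_) fun i => ?_
    · rcases i with d | v
      · exact (E.isCompact_dartArc d).isClosed
      · exact isClosed_singleton
    · rcases i with d | v
      · refine (hcont _ _ d.adj).continuousOn.congr fun z hz => ?_
        have h : ∃ d, z ∈ E.dartArc d := ⟨d, hz⟩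
        exact (dif_pos h).trans (hval _ _ z h.choose_spec hz)
      · exact continuousOn_singleton _ _

end GraphEmbeddingIn

/-- The relative position of `z` between `p` and `q`: it is `0` at `p` and `1` at `q`. -/
noncomputable def distRatio {X : Type*} [MetricSpace X] (p q z : X) : ℝ :=
  dist z p / (dist z p + dist z q)

section distRatio

variable {X : Type*} [MetricSpace X] {p q : X}

theorem dist_add_dist_pos_of_ne (h : p ≠ q) (z : X) : 0 < dist z p + dist z q :=
  (dist_pos.2 h).trans_le (dist_triangle_left p q z)

theorem continuous_distRatio (h : p ≠ q) : Continuous (distRatio p q) :=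
  Continuous.div (by fun_prop) (by fun_prop) fun z => (dist_add_dist_pos_of_ne h z).ne'

theorem distRatio_left : distRatio p q p = 0 := by simp [distRatio]

theorem distRatio_comm (h : p ≠ q) (z : X) : distRatio q p z = 1 - distRatio p q z := by
  have h1 := (dist_add_dist_pos_of_ne h z).ne'
  rw [distRatio, distRatio, add_comm (dist z q), eq_sub_iff_add_eq, ← add_div, add_comm,
    div_self h1]

end distRatio

/-- The lift of the colour `b` to an integer at distance at most one from the lift of `a`. -/
def centeredLift (a b : Fin 3) : ℤ :=
  (a : ℕ) + if b = a then 0 else if b = a + 1 then 1 else -1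

theorem centeredLift_of_eq_or_eq (a b c : Fin 3) (hab : a ≠ b) (hc : c = a ∨ c = b) :
    centeredLift c b - centeredLift c a = centeredLift a b - centeredLift a a ∧
      ∃ k : ℤ, centeredLift c a = centeredLift a a + 3 * k := by
  have h : ∀ a b c : Fin 3, a ≠ b → c = a ∨ c = b →
      centeredLift c b - centeredLift c a = centeredLift a b - centeredLift a a ∧
      ∃ k ∈ Finset.Icc (-1 : ℤ) 1, centeredLift c a = centeredLift a a + 3 * k := by decide
  obtain ⟨h1, k, -, hk⟩ := h a b c hab hc
  exact ⟨h1, k, hk⟩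

/-- Among the colours of a closed walk of length four in a 3-coloured graph, some colour occurs on
every edge. -/
theorem SimpleGraph.Coloring.exists_color_of_length_eq_four {V : Type*} {G : SimpleGraph V}
    (φ : G.Coloring (Fin 3)) {u : V} (W : G.Walk u u) (hW : W.length = 4) :
    ∃ a, ∀ d ∈ W.darts, φ d.fst = a ∨ φ d.snd = a := by
  match W, hW with
  | .cons (v := v) h₁ (.cons (v := w) h₂ (.cons (v := x) h₃ (.cons h₄ .nil))), _ =>
    have e₁ := φ.valid h₁
    have e₂ := φ.valid h₂
    have e₃ := φ.valid h₃
    have e₄ := φ.valid h₄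
    have key : ∀ a b c d : Fin 3, a ≠ b → b ≠ c → c ≠ d → d ≠ a → a = c ∨ b = d := by decide
    rcases key _ _ _ _ e₁ e₂ e₃ e₄ with h | h
    · exact ⟨φ u, by simp [h]⟩
    · exact ⟨φ v, by simp [h]⟩

namespace GraphEmbeddingIn

variable {X : Type*} [MetricSpace X] (E : GraphEmbeddingIn X G) (φ : G.Coloring (Fin 3))

/-- The interpolation along an edge of the lifts of the colours of its ends. -/
noncomputable def edgeLift (a : Fin 3) (u v : V) (z : X) : ℝ :=
  centeredLift a (φ u) + distRatio (E.vertexPos u) (E.vertexPos v) z *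
    (centeredLift a (φ v) - centeredLift a (φ u))

theorem continuous_edgeLift (a : Fin 3) {u v : V} (h : G.Adj u v) :
    Continuous (E.edgeLift φ a u v) :=
  continuous_const.add ((continuous_distRatio (E.vertexInj.ne h.ne)).mul continuous_const)

theorem edgeLift_comm (a : Fin 3) {u v : V} (h : G.Adj u v) :
    E.edgeLift φ a u v = E.edgeLift φ a v u := by
  ext z
  rw [edgeLift, edgeLift, distRatio_comm (E.vertexInj.ne h.ne)]
  ring

theorem edgeLift_left (a : Fin 3) (u v : V) :
    E.edgeLift φ a u v (E.vertexPos u) = centeredLift a (φ u) := by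
  simp [edgeLift, distRatio_left]

/-- The point of the unit circle that represents a real number modulo `3`. -/
noncomputable def circleMod (t : ℝ) : ℂ := Complex.exp (2 * Real.pi * Complex.I / 3 * t)

theorem circleMod_add_three_mul (t : ℝ) (k : ℤ) : circleMod (t + 3 * k) = circleMod t := by
  rw [circleMod, circleMod, Complex.exp_eq_exp_iff_exists_int]
  refine ⟨k, ?_⟩
  push_cast
  ring

theorem circleMod_edgeLift {u v : V} (h : G.Adj u v) {c : Fin 3} (hc : φ u = c ∨ φ v = c)
    (z : X) : circleMod (E.edgeLift φ c u v z) = circleMod (E.edgeLift φ (φ u) u v z) := by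
  obtain ⟨h1, k, hk⟩ := centeredLift_of_eq_or_eq (φ u) (φ v) c (φ.valid h)
    (hc.imp Eq.symm Eq.symm)
  have h1' : (centeredLift c (φ v) - centeredLift c (φ u) : ℝ) =
      centeredLift (φ u) (φ v) - centeredLift (φ u) (φ u) := by exact_mod_cast h1
  refine (congrArg circleMod ?_).trans (circleMod_add_three_mul _ k)
  rw [edgeLift, edgeLift, h1', hk]
  push_cast
  ring

/-- A 3-colouring induces a continuous map from the drawing to the circle. -/
theorem exists_circle_map [Finite V] : ∃ f : X → ℂ, ContinuousOn f E.drawing ∧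
    (∀ d : G.Dart, ∀ z ∈ E.dartArc d,
      f z = circleMod (E.edgeLift φ (φ d.fst) d.fst d.snd z)) ∧ ∀ z, f z ≠ 0 := by
  have hcont : ∀ u v, G.Adj u v → Continuous fun z => circleMod (E.edgeLift φ (φ u) u v z) :=
    fun u v h => by
      have := E.continuous_edgeLift φ (φ u) h
      unfold circleMod
      fun_prop
  have hsymm : ∀ u v, G.Adj u v → (fun z => circleMod (E.edgeLift φ (φ u) u v z)) =
      fun z => circleMod (E.edgeLift φ (φ v) v u z) := fun u v h => by
    ext z
    rw [← E.circleMod_edgeLift φ h (Or.inr rfl), E.edgeLift_comm φ _ h]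
  obtain ⟨f, hf, hfd, hf1⟩ := E.exists_continuousOn_drawing (1 : ℂ)
    (fun u v z => circleMod (E.edgeLift φ (φ u) u v z))
    (fun u => circleMod (centeredLift (φ u) (φ u))) hcont hsymm
    (fun u v _ => congrArg circleMod (E.edgeLift_left φ (φ u) u v))
  refine ⟨f, hf, hfd, fun z => ?_⟩
  by_cases hz : ∃ d, z ∈ E.dartArc d
  · obtain ⟨d, hd⟩ := hz
    rw [hfd d z hd]
    exact Complex.exp_ne_zero _
  · rw [hf1 z (not_exists.1 hz)]
    exact one_ne_zero

/-- The lifts of the colours centered at the colour `a` extend to the ambient space. -/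
theorem exists_continuous_lift [Finite V] (a : Fin 3) : ∃ g : X → ℝ, Continuous g ∧
    ∀ d : G.Dart, ∀ z ∈ E.dartArc d, g z = E.edgeLift φ a d.fst d.snd z := by
  obtain ⟨g, hg, hgd, -⟩ := E.exists_continuousOn_drawing 0 (fun u v => E.edgeLift φ a u v)
    (fun u => centeredLift a (φ u)) (fun u v h => E.continuous_edgeLift φ a h)
    (fun u v h => E.edgeLift_comm φ a h) (fun u v _ => E.edgeLift_left φ a u v)
  obtain ⟨g', hg'⟩ := ContinuousMap.exists_restrict_eq E.isCompact_drawing.isClosed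
    ⟨E.drawing.domRestrict g, hg.domRestrict⟩
  refine ⟨g', g'.continuous, fun d z hz => ?_⟩
  rw [← hgd d z hz]
  exact congrArg (fun h : C(E.drawing, ℝ) => h ⟨z, E.dartArc_subset_drawing d hz⟩) hg'

end GraphEmbeddingIn

/-- The map to the circle induced by a 3-colouring has a logarithm if all faces but one are bounded
by 4-cycles. -/
theorem GraphEmbeddingIn.hasLogOn_circle_map [Finite V] (E : GraphEmbeddingIn (ℝ × ℝ) G)
    (φ : G.Coloring (Fin 3)) {F : Set (ℝ × ℝ)} (hF : E.IsFace F)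
    (hother : ∀ F' : Set (ℝ × ℝ), E.IsFace F' → F' ≠ F →
      ∃ (u : V) (W' : G.Walk u u), W'.length = 4 ∧ frontier F' = E.walkDrawing W')
    {f : ℝ × ℝ → ℂ} (hf : ContinuousOn f E.drawing) (h0 : ∀ z ∈ E.drawing, f z ≠ 0)
    (hfd : ∀ d : G.Dart, ∀ z ∈ E.dartArc d,
      f z = circleMod (E.edgeLift φ (φ d.fst) d.fst d.snd z)) :
    HasLogOn f E.drawing := by
  choose g hg hgd using E.exists_continuous_lift φ
  refine hasLogOn_of_hasLogOn_frontiers (ι := Fin 3) E.isCompact_drawing hF hf h0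
    (g := fun a z => 2 * Real.pi * Complex.I / 3 * g a z)
    (fun a => by have := hg a; fun_prop) fun F' hF' hne => ?_
  obtain ⟨u, W', hlen, hW'⟩ := hother F' hF' hne
  obtain ⟨a, ha⟩ := φ.exists_color_of_length_eq_four W' hlen
  refine ⟨a, fun z hz => ?_⟩
  rw [hW', walkDrawing] at hz
  simp only [Set.mem_iUnion] at hz
  obtain ⟨d, hd, hz⟩ := hz
  refine ⟨E.dartArc_subset_drawing d hz, ?_⟩
  rw [hfd d z hz, ← E.circleMod_edgeLift φ d.adj (ha d hd), circleMod, hgd a d z hz]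

/-- Along an edge from a colour to its successor, a logarithm of the map to the circle grows by
a third of a period. -/
theorem GraphEmbeddingIn.log_sub_log_of_adj [Finite V] {X : Type*} [MetricSpace X]
    (E : GraphEmbeddingIn X G) (φ : G.Coloring (Fin 3)) {f g : X → ℂ}
    (hfd : ∀ d : G.Dart, ∀ z ∈ E.dartArc d,
      f z = circleMod (E.edgeLift φ (φ d.fst) d.fst d.snd z))
    (hg : ContinuousOn g E.drawing) (he : ∀ z ∈ E.drawing, Complex.exp (g z) = f z)
    {u v : V} (h : G.Adj u v) (huv : φ v = φ u + 1) :
    g (E.vertexPos v) - g (E.vertexPos u) = 2 * Real.pi * Complex.I / 3 := by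
  set d : G.Dart := ⟨(u, v), h⟩
  have hsub := E.dartArc_subset_drawing d
  have hc := E.continuous_edgeLift φ (φ u) h
  have := sub_eq_sub_of_exp_eq (E.isPreconnected_dartArc d) (hg.mono hsub)
    (b := fun z => 2 * Real.pi * Complex.I / 3 * E.edgeLift φ (φ u) u v z) (by fun_prop)
    (fun z hz => (he z (hsub hz)).trans (hfd d z hz)) (E.vertexPos_fst_mem d)
    (E.vertexPos_snd_mem d)
  have h1 : E.edgeLift φ (φ u) u v (E.vertexPos d.snd) = centeredLift (φ u) (φ v) := by
    rw [E.edgeLift_comm φ _ h]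
    exact E.edgeLift_left φ _ v u
  have h2 : E.edgeLift φ (φ u) u v (E.vertexPos d.fst) = centeredLift (φ u) (φ u) :=
    E.edgeLift_left φ _ u v
  have h3 : centeredLift (φ u) (φ v) = centeredLift (φ u) (φ u) + 1 := by
    rw [huv]
    exact (by decide : ∀ a : Fin 3, centeredLift a (a + 1) = centeredLift a a + 1) _
  simp only [h1, h2, h3] at this
  push_cast at this
  linear_combination -this

/-- Aksenov's tightness example: a plane graph all of whose faces are 4-faces except one
6-face `v₁v₂v₃v₄v₅v₆` has no proper 3-coloring giving the boundary the color pattern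
`(1,2,3,1,2,3)`. -/
theorem no_123123_coloring_of_hexagonal_face [Fintype V] (G : SimpleGraph V)
    (E : GraphEmbeddingIn (ℝ × ℝ) G)
    (v₁ v₂ v₃ v₄ v₅ v₆ : V)
    (F : Set (ℝ × ℝ)) (hF : E.IsFace F)
    (W : G.Walk v₁ v₁) (hW : W.IsCycle)
    (hsupp : W.support = [v₁, v₂, v₃, v₄, v₅, v₆, v₁])
    (hbd : frontier F = E.walkDrawing W)
    (hother : ∀ F' : Set (ℝ × ℝ), E.IsFace F' → F' ≠ F →
      ∃ (u : V) (W' : G.Walk u u), W'.IsCycle ∧ W'.length = 4 ∧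
        frontier F' = E.walkDrawing W') :
    ¬ ∃ φ : G.Coloring (Fin 3),
        φ v₁ = 0 ∧ φ v₂ = 1 ∧ φ v₃ = 2 ∧ φ v₄ = 0 ∧ φ v₅ = 1 ∧ φ v₆ = 2 := by
  rintro ⟨φ, h₁, h₂, h₃, h₄, h₅, h₆⟩
  obtain ⟨f, hf, hfd, hf0⟩ := E.exists_circle_map φ
  obtain ⟨g, hg, he⟩ := E.hasLogOn_circle_map φ hF
    (fun F' hF' hne =>
      let ⟨u, W', _, hlen, hfr⟩ := hother F' hF' hne
      ⟨u, W', hlen, hfr⟩)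
    hf (fun z _ => hf0 z) hfd
  have hadj := W.isChain_adj_support
  rw [hsupp] at hadj
  simp only [List.isChain_cons_cons, List.isChain_singleton, and_true] at hadj
  obtain ⟨a₁, a₂, a₃, a₄, a₅, a₆⟩ := hadj
  have e₁ := E.log_sub_log_of_adj φ hfd hg he a₁ (by rw [h₁, h₂]; rfl)
  have e₂ := E.log_sub_log_of_adj φ hfd hg he a₂ (by rw [h₂, h₃]; rfl)
  have e₃ := E.log_sub_log_of_adj φ hfd hg he a₃ (by rw [h₃, h₄]; rfl)
  have e₄ := E.log_sub_log_of_adj φ hfd hg he a₄ (by rw [h₄, h₅]; rfl)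
  have e₅ := E.log_sub_log_of_adj φ hfd hg he a₅ (by rw [h₅, h₆]; rfl)
  have e₆ := E.log_sub_log_of_adj φ hfd hg he a₆ (by rw [h₆, h₁]; rfl)
  refine Complex.two_pi_I_ne_zero ?_
  linear_combination -(e₁ + e₂ + e₃ + e₄ + e₅ + e₆) / 2
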